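/- arXiv:2508.01792 — 2 statements merged into one kernel-verified Lean document; each statement's English description precedes it below -/
import Mathlib

section
/- Let X be at the same time a simplicial complex of rank n ≥ 1 and an n-PCM. Then for every h ∈ ΔX the poset lk(h, ΔX) is order-isomorphic to the poset Δ(lk(h, X)), where lk denotes the link and Δ the border operator. -/
namespace PCMPaper

variable {α : Type*} [PartialOrder α]

/-- The set of elements of `X` strictly below `h` (α□_X(h)). -/
def alphaS (X : Set α) (h : α) : Set α := {x ∈ X | x < h}

/-- The set of elements of `X` strictly above `h` (β□_X(h)). -/
def betaS (X : Set α) (h : α) : Set α := {x ∈ X | h < x}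

/-- The (strict) neighborhood θ□_X(h) = α□_X(h) ∪ β□_X(h). -/
def thetaS (X : Set α) (h : α) : Set α := alphaS X h ∪ betaS X h

/-- The rank of `h` in the poset `X`: the maximal length of a strictly increasing
chain in `X` ending at `h`.  (It equals 0 when α□_X(h) = ∅ and
`max_{x ∈ α□_X(h)} rank X x + 1` otherwise, for finite `X`.) -/
noncomputable def rank (X : Set α) (h : α) : ℕ :=
  sSup {n : ℕ | ∃ c : Fin (n + 1) → α, StrictMono c ∧ (∀ i, c i ∈ X) ∧ c (Fin.last n) = h}

open scoped Classical in
/-- The rank of the poset `X`: maximal rank of its elements, `-1` if empty. -/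
noncomputable def rankSet (X : Set α) : ℤ :=
  if X = ∅ then -1 else ((sSup (rank X '' X) : ℕ) : ℤ)

/-- One step of a path in `X`: two distinct comparable elements of `X`. -/
def rel (X : Set α) (x y : α) : Prop :=
  x ∈ X ∧ y ∈ X ∧ x ≠ y ∧ (x < y ∨ y < x)

/-- `X` is (path-)connected: any two elements are joined by a path in `X`. -/
def IsConnected (X : Set α) : Prop :=
  ∀ x ∈ X, ∀ y ∈ X, Relation.ReflTransGen (rel X) x y

/-- `IsSurfaceAux (k + 1) X` means that `X` is a (discrete) `k`-surface. -/
def IsSurfaceAux : ℕ → Set α → Prop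
  | 0, X => X = ∅
  | 1, X => ∃ x y : α, x ≠ y ∧ ¬ x < y ∧ ¬ y < x ∧ X = {x, y}
  | (n + 2), X => X.Nonempty ∧ IsConnected X ∧ ∀ h ∈ X, IsSurfaceAux (n + 1) (thetaS X h)

/-- `X` is a discrete `k`-surface (`k : ℤ`, `k ≥ -1`). -/
def IsSurface (k : ℤ) (X : Set α) : Prop :=
  ∃ n : ℕ, (n : ℤ) = k + 1 ∧ IsSurfaceAux n X

/-- The border ΔX of a poset `X` of rank `n`:
elements whose neighborhood is not an `(n-1)`-surface. -/
def border (X : Set α) : Set α :=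
  {h ∈ X | ¬ IsSurface (rankSet X - 1) (thetaS X h)}

/-- The interior of `X`. -/
def interior' (X : Set α) : Set α := X \ border X

/-- `IsPCMAux (n + 1) X` means that `X` is an `n`-PCM. -/
def IsPCMAux : ℕ → Set α → Prop
  | 0, X => X = ∅
  | 1, X => ∃ x : α, X = {x}
  | (n + 2), X => rankSet X = ((n : ℤ) + 1) ∧ IsConnected X ∧ border X ≠ ∅ ∧
      ∀ h ∈ X, (h ∈ border X → IsPCMAux (n + 1) (thetaS X h)) ∧
               (h ∉ border X → IsSurfaceAux (n + 1) (thetaS X h))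

/-- `X` is an `k`-PCM (`k : ℤ`, `k ≥ -1`). -/
def IsPCM (k : ℤ) (X : Set α) : Prop :=
  ∃ n : ℕ, (n : ℤ) = k + 1 ∧ IsPCMAux n X

/-- Fuel-indexed coherence. -/
def IsCoherentAux : ℕ → Set α → Prop
  | 0, X => X = ∅
  | (n + 1), X => X = ∅ ∨
      ∀ h ∈ X, rankSet (thetaS X h) = rankSet X - 1 ∧ IsCoherentAux n (thetaS X h)

/-- `X` is a coherent poset. -/
def IsCoherent (X : Set α) : Prop := ∃ n : ℕ, IsCoherentAux n X

/-- `X` is a separated union of `(m-1)`-surfaces: a union of `(m-1)`-surfaces such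
that no element of one of them is comparable to an element of another one. -/
def IsSeparatedUnionOfSurfacesAux (m : ℕ) (X : Set α) : Prop :=
  ∃ P : Set (Set α), P.Nonempty ∧ X = ⋃₀ P ∧ (∀ S ∈ P, IsSurfaceAux m S) ∧
    ∀ S ∈ P, ∀ T ∈ P, S ≠ T → ∀ x ∈ S, ∀ y ∈ T, ¬ x ≤ y ∧ ¬ y ≤ x

/-- `IsSmoothPCMAux (n + 1) X` means that `X` is a smooth `n`-PCM. -/
def IsSmoothPCMAux : ℕ → Set α → Prop
  | 0, X => X = ∅
  | 1, X => ∃ x : α, X = {x}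
  | (n + 2), X => rankSet X = ((n : ℤ) + 1) ∧ IsConnected X ∧ border X ≠ ∅ ∧
      IsSeparatedUnionOfSurfacesAux (n + 1) (border X) ∧
      ∀ h ∈ X, IsSurfaceAux (n + 1) (thetaS X h) ∨ IsSmoothPCMAux (n + 1) (thetaS X h)

/-- `X` is a smooth `k`-PCM (`k : ℤ`, `k ≥ -1`). -/
def IsSmoothPCM (k : ℤ) (X : Set α) : Prop :=
  ∃ n : ℕ, (n : ℤ) = k + 1 ∧ IsSmoothPCMAux n X

/-- A simplicial complex: a finite family of nonempty finite sets, closed under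
taking nonempty subsets and under nonempty intersections. -/
def IsSimplicialComplex {V : Type*} [DecidableEq V] (X : Set (Finset V)) : Prop :=
  X.Finite ∧ (∀ h ∈ X, h.Nonempty) ∧
  (∀ h ∈ X, ∀ h' : Finset V, h'.Nonempty → h' ⊆ h → h' ∈ X) ∧
  (∀ h ∈ X, ∀ h' ∈ X, (h ∩ h').Nonempty → h ∩ h' ∈ X)

/-- The dimension of a simplex. -/
def dim {V : Type*} (h : Finset V) : ℤ := (h.card : ℤ) - 1

/-- The link of a simplex `h` in a family of simplices `S`. -/
def link {V : Type*} [DecidableEq V] (h : Finset V) (S : Set (Finset V)) : Set (Finset V) :=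
  {h' ∈ S | h ∩ h' = ∅ ∧ h ∪ h' ∈ S}

/-- `X` is pure of rank `n`: every simplex is contained in an `n`-dimensional one. -/
def Pure {V : Type*} (X : Set (Finset V)) (n : ℤ) : Prop :=
  ∀ h ∈ X, ∃ g ∈ X, h ⊆ g ∧ dim g = n

/-- Any two `n`-simplices of `X` are joined by a path in `X` all of whose elements
are simplices of dimension `n - 1` or `n` (i.e. `X` is `(n-1)`-connected). -/
def NConnected {V : Type*} (X : Set (Finset V)) (n : ℤ) : Prop :=
  ∀ a ∈ X, dim a = n → ∀ b ∈ X, dim b = n →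
    Relation.ReflTransGen (rel {h | h ∈ X ∧ (dim h = n - 1 ∨ dim h = n)}) a b

/-- `X` is a pseudomanifold of rank `n`. -/
def IsPseudomanifold {V : Type*} [DecidableEq V] (X : Set (Finset V)) (n : ℤ) : Prop :=
  IsSimplicialComplex X ∧ rankSet X = n ∧
  ((n = 0 ∧ ∃ v : V, X = {({v} : Finset V)}) ∨
   (1 ≤ n ∧ Pure X n ∧
    (∀ h ∈ X, dim h = n - 1 →
      Set.ncard {g | g ∈ X ∧ h ⊆ g ∧ dim g = n} ∈ ({1, 2} : Set ℕ)) ∧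
    NConnected X n))

/-- `X` is a normal pseudomanifold of rank `n`: a pseudomanifold such that the link
of every simplex of dimension at most `n - 2` is a pseudomanifold. -/
def IsNormalPseudomanifold {V : Type*} [DecidableEq V] (X : Set (Finset V)) (n : ℤ) : Prop :=
  IsPseudomanifold X n ∧
  ∀ h ∈ X, dim h ≤ n - 2 → IsPseudomanifold (link h X) (n - dim h - 1)

lemma mem_thetaS {X : Set α} {h x : α} : x ∈ thetaS X h ↔ x ∈ X ∧ (x < h ∨ h < x) := by
  simp only [thetaS, alphaS, betaS, Set.mem_union, Set.mem_ofPred_eq]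
  tauto

lemma IsSurfaceAux.nonempty {m : ℕ} {X : Set α} (hX : IsSurfaceAux (m + 1) X) : X.Nonempty := by
  cases m with
  | zero =>
    obtain ⟨x, y, -, -, -, rfl⟩ := hX
    exact ⟨x, by simp⟩
  | succ m => exact hX.1

/-- Neighborhoods in an `m`-surface are `(m-1)`-surfaces. -/
lemma IsSurfaceAux.neighborhood {m : ℕ} {X : Set α} (hX : IsSurfaceAux (m + 1) X) {x : α}
    (hx : x ∈ X) : IsSurfaceAux m (thetaS X x) := by
  cases m with
  | zero =>
    obtain ⟨a, b, -, h1, h2, rfl⟩ := hX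
    change thetaS _ _ = ∅
    ext z
    simp only [mem_thetaS, Set.mem_insert_iff, Set.mem_singleton_iff, Set.mem_empty_iff_false,
      iff_false] at hx ⊢
    rintro ⟨rfl | rfl, hz⟩ <;> rcases hx with rfl | rfl <;> simp_all
  | succ m => exact hX.2.2 x hx

lemma reflTransGen_rel_of_le {X : Set α} {x y : α} (hx : x ∈ X) (hy : y ∈ X)
    (hxy : x ≤ y ∨ y ≤ x) : Relation.ReflTransGen (rel X) x y := by
  by_cases e : x = y
  · rw [e]
  · refine Relation.ReflTransGen.single ⟨hx, hy, e, ?_⟩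
    exact hxy.imp (fun h => lt_of_le_of_ne h e) (fun h => lt_of_le_of_ne h (Ne.symm e))

lemma thetaS_union_of_mem_left {A B : Set α} (hAB : ∀ a ∈ A, ∀ b ∈ B, a < b) {x : α}
    (hx : x ∈ A) : thetaS (A ∪ B) x = thetaS A x ∪ B := by
  ext z
  have := hAB x hx z
  simp only [mem_thetaS, Set.mem_union]
  tauto

lemma thetaS_union_of_mem_right {A B : Set α} (hAB : ∀ a ∈ A, ∀ b ∈ B, a < b) {x : α}
    (hx : x ∈ B) : thetaS (A ∪ B) x = A ∪ thetaS B x := by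
  ext z
  have := fun hz => hAB z hz x hx
  simp only [mem_thetaS, Set.mem_union]
  tauto

/-- The ordinal join of two surfaces is a surface. -/
lemma IsSurfaceAux.join {a b : ℕ} {A B : Set α} (hA : IsSurfaceAux a A) (hB : IsSurfaceAux b B)
    (hAB : ∀ x ∈ A, ∀ y ∈ B, x < y) : IsSurfaceAux (a + b) (A ∪ B) := by
  induction hs : a + b generalizing a b A B with
  | zero =>
    obtain ⟨rfl, rfl⟩ : a = 0 ∧ b = 0 := by omega
    change A = ∅ at hA
    change B = ∅ at hB
    simp [hA, hB, IsSurfaceAux]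
  | succ s ih =>
    rcases a with _ | a
    · change A = ∅ at hA
      obtain rfl : b = s + 1 := by omega
      simpa [hA] using hB
    rcases b with _ | b
    · change B = ∅ at hB
      obtain rfl : a = s := by omega
      simpa [hB] using hA
    obtain ⟨s, rfl⟩ : ∃ t, s = t + 1 := ⟨a + b, by omega⟩
    obtain ⟨p, hp⟩ := hA.nonempty
    obtain ⟨q, hq⟩ := hB.nonempty
    refine ⟨⟨p, Or.inl hp⟩, ?_, ?_⟩
    · have hcross : ∀ x ∈ A, ∀ y ∈ B, Relation.ReflTransGen (rel (A ∪ B)) x y ∧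
          Relation.ReflTransGen (rel (A ∪ B)) y x := fun x hx y hy =>
        have hx' : x ∈ A ∪ B := Or.inl hx
        have hy' : y ∈ A ∪ B := Or.inr hy
        ⟨reflTransGen_rel_of_le hx' hy' (Or.inl (hAB x hx y hy).le),
          reflTransGen_rel_of_le hy' hx' (Or.inr (hAB x hx y hy).le)⟩
      rintro x (hx | hx) y (hy | hy)
      · exact (hcross x hx q hq).1.trans (hcross y hy q hq).2
      · exact (hcross x hx y hy).1
      · exact (hcross y hy x hx).2
      · exact (hcross p hp x hx).2.trans (hcross p hp y hy).1
    · rintro x (hx | hx)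
      · rw [thetaS_union_of_mem_left hAB hx]
        exact ih (hA.neighborhood hx) hB (fun z hz => hAB z (mem_thetaS.1 hz).1) (by omega)
      · rw [thetaS_union_of_mem_right hAB hx]
        exact ih hA (hB.neighborhood hx) (fun z hz y hy => hAB z hz y (mem_thetaS.1 hy).1) (by omega)

/-- If an ordinal join and its lower factor are surfaces, then so is the upper factor. -/
lemma IsSurfaceAux.right_of_join {a m : ℕ} {A B : Set α} (hA : IsSurfaceAux a A)
    (hm : IsSurfaceAux m (A ∪ B)) (hAB : ∀ x ∈ A, ∀ y ∈ B, x < y) :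
    ∃ b, a + b = m ∧ IsSurfaceAux b B := by
  induction a generalizing m A with
  | zero =>
    change A = ∅ at hA
    exact ⟨m, by omega, by simpa [hA] using hm⟩
  | succ a ih =>
    obtain ⟨x, hx⟩ := hA.nonempty
    rcases m with _ | m
    · change A ∪ B = ∅ at hm
      exact absurd (Set.mem_union_left B hx) (by simp [hm])
    · have h1 := hm.neighborhood (Set.mem_union_left B hx)
      rw [thetaS_union_of_mem_left hAB hx] at h1
      obtain ⟨b, hb, hB⟩ := ih (hA.neighborhood hx) h1 (fun z hz => hAB z (mem_thetaS.1 hz).1)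
      exact ⟨b, by omega, hB⟩

/-- Surfaces are preserved by order isomorphisms. -/
lemma IsSurfaceAux.image {β : Type*} [PartialOrder β] {m : ℕ} {X : Set α}
    (hX : IsSurfaceAux m X) {f : α → β} (hinj : Set.InjOn f X)
    (hf : ∀ x ∈ X, ∀ y ∈ X, f x < f y ↔ x < y) : IsSurfaceAux m (f '' X) := by
  induction m generalizing X with
  | zero =>
    change X = ∅ at hX
    simp [hX, IsSurfaceAux]
  | succ m ih =>
    rcases m with _ | m
    · obtain ⟨x, y, hne, h1, h2, rfl⟩ := hX
      refine ⟨f x, f y, fun e => hne (hinj (by simp) (by simp) e), ?_, ?_, by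
        rw [Set.image_pair]⟩
      · rwa [hf _ (by simp) _ (by simp)]
      · rwa [hf _ (by simp) _ (by simp)]
    · refine ⟨hX.1.image f, ?_, ?_⟩
      · rintro _ ⟨x, hx, rfl⟩ _ ⟨y, hy, rfl⟩
        refine Relation.ReflTransGen.lift f ?_ _ _ (hX.2.1 x hx y hy)
        rintro u v ⟨hu, hv, huv, hlt⟩
        refine ⟨Set.mem_image_of_mem f hu, Set.mem_image_of_mem f hv,
          fun e => huv (hinj hu hv e), ?_⟩
        rwa [hf u hu v hv, hf v hv u hu]
      · rintro _ ⟨x, hx, rfl⟩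
        have hsub : thetaS X x ⊆ X := fun z hz => (mem_thetaS.1 hz).1
        have e : thetaS (f '' X) (f x) = f '' thetaS X x := by
          ext z
          simp only [mem_thetaS, Set.mem_image]
          constructor
          · rintro ⟨⟨y, hy, rfl⟩, hz⟩
            rw [hf y hy x hx, hf x hx y hy] at hz
            exact ⟨y, ⟨hy, hz⟩, rfl⟩
          · rintro ⟨y, ⟨hy, hz⟩, rfl⟩
            rw [hf y hy x hx, hf x hx y hy]
            exact ⟨⟨y, hy, rfl⟩, hz⟩
        rw [e]
        exact ih (hX.2.2 x hx) (hinj.mono hsub)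
          (fun a ha b hb => hf a (hsub ha) b (hsub hb))

section Simplex

variable {V : Type*} [DecidableEq V]

/-- The nonempty proper subsets of a finite set. -/
def simplexBoundary (g : Finset V) : Set (Finset V) := {s | s.Nonempty ∧ s ⊂ g}

/-- Adding a fixed set to simplices disjoint from it preserves surfaces. -/
lemma IsSurfaceAux.union_image {m : ℕ} {X : Set (Finset V)} (hX : IsSurfaceAux m X)
    {h : Finset V} (hd : ∀ s ∈ X, Disjoint h s) : IsSurfaceAux m ((fun s => h ∪ s) '' X) := by
  refine hX.image ?_ ?_
  · intro s hs t ht e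
    have e1 : (h ∪ s) \ h = (h ∪ t) \ h := by rw [show h ∪ s = h ∪ t from e]
    rwa [Finset.union_sdiff_cancel_left (hd s hs), Finset.union_sdiff_cancel_left (hd t ht)] at e1
  · intro s hs t ht
    have key : ∀ a ∈ X, ∀ b ∈ X, h ∪ a ⊆ h ∪ b ↔ a ⊆ b := by
      intro a ha b hb
      refine ⟨fun hab => ?_, fun hab => Finset.union_subset_union_right hab⟩
      have := Finset.sdiff_subset_sdiff hab (le_refl h)
      rwa [Finset.union_sdiff_cancel_left (hd a ha),
        Finset.union_sdiff_cancel_left (hd b hb)] at this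
    change h ∪ s ⊂ h ∪ t ↔ s ⊂ t
    rw [ssubset_iff_subset_not_subset, ssubset_iff_subset_not_subset, key s hs t ht, key t ht s hs]

/-- Removing a fixed common subset from simplices preserves surfaces. -/
lemma IsSurfaceAux.sdiff_image {m : ℕ} {X : Set (Finset V)} (hX : IsSurfaceAux m X)
    {h : Finset V} (hd : ∀ s ∈ X, h ⊆ s) : IsSurfaceAux m ((fun s => s \ h) '' X) := by
  have key : ∀ a ∈ X, ∀ b ∈ X, a \ h ⊆ b \ h ↔ a ⊆ b := by
    intro a ha b hb
    refine ⟨fun hab => ?_, fun hab => Finset.sdiff_subset_sdiff hab (le_refl h)⟩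
    rw [← Finset.sdiff_union_of_subset (hd a ha), ← Finset.sdiff_union_of_subset (hd b hb)]
    exact Finset.union_subset_union_left hab
  refine hX.image ?_ ?_
  · intro s hs t ht e
    exact Finset.Subset.antisymm ((key s hs t ht).1 (Finset.Subset.antisymm_iff.1 e).1)
      ((key t ht s hs).1 (Finset.Subset.antisymm_iff.1 e).2)
  · intro s hs t ht
    rw [ssubset_iff_subset_not_subset, ssubset_iff_subset_not_subset, key s hs t ht, key t ht s hs]

lemma union_image_simplexBoundary_sdiff {x g : Finset V} (hxg : x ⊆ g) :
    (fun s => x ∪ s) '' simplexBoundary (g \ x) = {s | x < s ∧ s < g} := by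
  ext s
  simp only [simplexBoundary, Set.mem_image, Set.mem_ofPred_eq]
  constructor
  · rintro ⟨t, ⟨⟨v, hv⟩, htg⟩, rfl⟩
    have hvx := (Finset.mem_sdiff.1 (htg.1 hv)).2
    refine ⟨Finset.ssubset_iff_subset_ne.2 ⟨Finset.subset_union_left, fun e => hvx ?_⟩,
      Finset.union_subset hxg (htg.1.trans Finset.sdiff_subset), fun hg => htg.2 ?_⟩
    · rw [e]; exact Finset.mem_union_right _ hv
    · intro w hw
      have := Finset.mem_union.1 (hg (Finset.mem_sdiff.1 hw).1)
      exact this.resolve_left (Finset.mem_sdiff.1 hw).2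
  · rintro ⟨h1, h2⟩
    refine ⟨s \ x, ⟨Finset.sdiff_nonempty.2 h1.2,
      Finset.sdiff_subset_sdiff h2.1 (le_refl x), fun hg => h2.2 ?_⟩,
      Finset.union_sdiff_of_subset h1.1⟩
    intro w hw
    by_cases hwx : w ∈ x
    · exact h1.1 hwx
    · exact (Finset.mem_sdiff.1 (hg (Finset.mem_sdiff.2 ⟨hw, hwx⟩))).1

lemma isConnected_simplexBoundary {g : Finset V} (hg : 3 ≤ g.card) :
    IsConnected (simplexBoundary g) := by
  have hsub : ∀ t ⊆ g, t.Nonempty → t.card ≤ 2 → t ∈ simplexBoundary g := by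
    intro t ht hne hc
    exact ⟨hne, Finset.ssubset_iff_subset_ne.2 ⟨ht, fun e => by subst e; omega⟩⟩
  rintro s ⟨⟨a, ha⟩, hs⟩ t ⟨⟨b, hb⟩, ht⟩
  have hag := hs.1 ha
  have hbg := ht.1 hb
  have h1 : ({a} : Finset V) ∈ simplexBoundary g :=
    hsub _ (by simpa using hag) (by simp) (by simp)
  have h2 : ({b} : Finset V) ∈ simplexBoundary g :=
    hsub _ (by simpa using hbg) (by simp) (by simp)
  have h3 : ({a, b} : Finset V) ∈ simplexBoundary g :=
    hsub _ (by simp [Finset.insert_subset_iff, hag, hbg]) (by simp) Finset.card_le_two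
  have hs' : s ∈ simplexBoundary g := ⟨⟨a, ha⟩, hs⟩
  have ht' : t ∈ simplexBoundary g := ⟨⟨b, hb⟩, ht⟩
  exact (((reflTransGen_rel_of_le hs' h1 (Or.inr (by simpa using ha))).trans
    (reflTransGen_rel_of_le h1 h3 (Or.inl (by simp)))).trans
    (reflTransGen_rel_of_le h3 h2 (Or.inr (by simp)))).trans
    (reflTransGen_rel_of_le h2 ht' (Or.inl (by simpa using hb)))

/-- The boundary of a simplex of dimension `m` is an `(m-1)`-surface. -/
lemma isSurfaceAux_simplexBoundary {m : ℕ} {g : Finset V} (hg : g.card = m + 1) :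
    IsSurfaceAux m (simplexBoundary g) := by
  induction m using Nat.strong_induction_on generalizing g with
  | _ m ih =>
    rcases m with _ | _ | m
    · change simplexBoundary g = ∅
      refine Set.eq_empty_of_forall_notMem ?_
      rintro s ⟨hs, hsg⟩
      have h1 := Finset.card_lt_card hsg
      have h2 := hs.card_pos
      omega
    · obtain ⟨a, b, hab, rfl⟩ := Finset.card_eq_two.1 hg
      refine ⟨{a}, {b}, by simpa using hab, fun h => ?_, fun h => ?_, ?_⟩
      · simpa using Finset.card_lt_card h
      · simpa using Finset.card_lt_card h
      · ext s
        simp only [simplexBoundary, Set.mem_ofPred_eq, Set.mem_insert_iff, Set.mem_singleton_iff]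
        constructor
        · rintro ⟨hs, hsg⟩
          have h1 := Finset.card_lt_card hsg
          have h2 := hs.card_pos
          obtain ⟨c, rfl⟩ := Finset.card_eq_one.1 (show s.card = 1 by omega)
          have := hsg.1 (Finset.mem_singleton_self c)
          simpa using this
        · rintro (rfl | rfl)
          · refine ⟨by simp, Finset.ssubset_iff_subset_ne.2 ⟨by simp, fun e => ?_⟩⟩
            rw [← e] at hg; simp at hg
          · refine ⟨by simp, Finset.ssubset_iff_subset_ne.2 ⟨by simp, fun e => ?_⟩⟩
            rw [← e] at hg; simp at hg
    · refine ⟨?_, isConnected_simplexBoundary (by omega), ?_⟩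
      · obtain ⟨a, ha⟩ := Finset.card_pos.1 (show 0 < g.card by omega)
        exact ⟨{a}, by simp, Finset.ssubset_iff_subset_ne.2
          ⟨by simpa using ha, fun e => by rw [← e] at hg; simp at hg⟩⟩
      · rintro x ⟨hx, hxg⟩
        have h1 := Finset.card_lt_card hxg
        have h2 := hx.card_pos
        have h3 := Finset.card_sdiff_add_card_eq_card hxg.1
        have hlow := ih (x.card - 1) (by omega) (g := x) (by omega)
        have hup := (ih (m + 1 - (x.card - 1)) (by omega) (g := g \ x) (by omega)).union_image
          (h := x) (fun s hs => (Finset.disjoint_sdiff (s := x) (t := g)).mono_right hs.2.1)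
        rw [union_image_simplexBoundary_sdiff hxg.1] at hup
        have := hlow.join hup (fun s hs t ht => lt_trans hs.2 ht.1)
        rw [show x.card - 1 + (m + 1 - (x.card - 1)) = m + 1 by omega] at this
        convert this using 1
        ext s
        simp only [mem_thetaS, simplexBoundary, Set.mem_ofPred_eq, Set.mem_union]
        constructor
        · rintro ⟨⟨hs, hsg⟩, hlt | hlt⟩
          · exact Or.inl ⟨hs, hlt⟩
          · exact Or.inr ⟨hlt, hsg⟩
        · rintro (⟨hs, hlt⟩ | ⟨hlt, hsg⟩)
          · exact ⟨⟨hs, hlt.trans hxg⟩, Or.inl hlt⟩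
          · exact ⟨⟨hx.mono hlt.1, hsg⟩, Or.inr hlt⟩

end Simplex

lemma nat_sSup_mem_or_eq_zero {S : Set ℕ} (hS : S.Nonempty) : sSup S ∈ S ∨ sSup S = 0 := by
  by_cases hb : BddAbove S
  · exact Or.inl (Nat.sSup_mem hS hb)
  · exact Or.inr (Nat.sSup_of_not_bddAbove hb)

/-- A poset of rank `m` contains a chain with `m + 1` elements. -/
lemma exists_chain_of_rankSet_eq {X : Set α} {m : ℕ} (hX : rankSet X = m) :
    ∃ c : Fin (m + 1) → α, StrictMono c ∧ ∀ i, c i ∈ X := by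
  have hne : X ≠ ∅ := by
    rintro rfl
    simp [rankSet] at hX
  have hs : sSup (rank X '' X) = m := by
    simpa [rankSet, hne] using hX
  obtain ⟨x, hx⟩ := Set.nonempty_iff_ne_empty.2 hne
  rcases Nat.eq_zero_or_pos m with rfl | hm
  · exact ⟨fun _ => x, fun i j hij => by omega, fun _ => hx⟩
  · obtain h0 | h0 := nat_sSup_mem_or_eq_zero (S := rank X '' X) ⟨_, x, hx, rfl⟩
    · rw [hs] at h0
      obtain ⟨y, hy, hyr⟩ := h0
      obtain h1 | h1 := nat_sSup_mem_or_eq_zero (S := {n : ℕ | ∃ c : Fin (n + 1) → α,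
        StrictMono c ∧ (∀ i, c i ∈ X) ∧ c (Fin.last n) = y})
        ⟨0, fun _ => y, fun i j hij => by omega,
          fun _ => hy, rfl⟩
      · change rank X y ∈ _ at h1
        rw [hyr] at h1
        obtain ⟨c, hc, hcX, -⟩ := h1
        exact ⟨c, hc, hcX⟩
      · change rank X y = 0 at h1
        omega
    · omega

/-- An `m`-PCM contains a chain with `m + 1` elements. -/
lemma IsPCMAux.exists_chain {X : Set α} {m : ℕ} (hX : IsPCMAux (m + 1) X) :
    ∃ c : Fin (m + 1) → α, StrictMono c ∧ ∀ i, c i ∈ X := by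
  rcases m with _ | m
  · obtain ⟨x, rfl⟩ := hX
    exact ⟨fun _ => x, fun i j hij => by omega, fun _ => rfl⟩
  · exact exists_chain_of_rankSet_eq (by exact_mod_cast hX.1)

lemma lt_card_of_strictMono {V : Type*} {m : ℕ} {c : Fin (m + 1) → Finset V} (hc : StrictMono c)
    (hne : ∀ i, (c i).Nonempty) : m < (c (Fin.last m)).card := by
  have : ∀ i : Fin (m + 1), (i : ℕ) < (c i).card := by
    intro i
    induction i using Fin.induction with
    | zero => exact (hne 0).card_pos
    | succ i ih =>
      have h1 := Finset.card_lt_card (hc (Fin.castSucc_lt_succ (i := i)))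
      simp only [Fin.val_castSucc] at ih
      simp only [Fin.val_succ]
      omega
  simpa using this (Fin.last m)

section Complex

variable {V : Type*} [DecidableEq V]

lemma exists_chain_of_card_eq {m : ℕ} {g : Finset V} (hg : g.card = m + 1) :
    ∃ c : Fin (m + 1) → Finset V, StrictMono c ∧ (∀ i, (c i).Nonempty ∧ c i ⊆ g) ∧
      c (Fin.last m) = g := by
  induction m generalizing g with
  | zero =>
    refine ⟨fun _ => g, fun i j hij => by omega,
      fun _ => ⟨Finset.card_pos.1 (show 0 < g.card by omega), Finset.Subset.refl g⟩, rfl⟩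
  | succ m ih =>
    obtain ⟨a, t, ha, rfl, ht⟩ := Finset.card_eq_succ.1 hg
    obtain ⟨c, hc, hcg, hl⟩ := ih ht
    refine ⟨Fin.snoc c (insert a t), ?_, ?_, by simp⟩
    · rw [Fin.strictMono_iff_lt_succ]
      intro i
      induction i using Fin.lastCases with
      | last =>
        rw [Fin.succ_last, Fin.snoc_last, Fin.snoc_castSucc, hl]
        exact Finset.ssubset_insert ha
      | cast i =>
        rw [Fin.succ_castSucc, Fin.snoc_castSucc, Fin.snoc_castSucc]
        exact hc (Fin.castSucc_lt_succ)
    · intro i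
      induction i using Fin.lastCases with
      | last => simp
      | cast i =>
        rw [Fin.snoc_castSucc]
        exact ⟨(hcg i).1, (hcg i).2.trans (Finset.subset_insert a t)⟩

lemma rank_eq_of_isSimplicialComplex {X : Set (Finset V)} (hX : IsSimplicialComplex X)
    {g : Finset V} (hg : g ∈ X) : rank X g = g.card - 1 := by
  have hpos := (hX.2.1 g hg).card_pos
  refine IsGreatest.csSup_eq ⟨?_, ?_⟩
  · obtain ⟨c, hc, hcg, hl⟩ := exists_chain_of_card_eq (m := g.card - 1) (g := g) (by omega)
    exact ⟨c, hc, fun i => hX.2.2.1 g hg _ (hcg i).1 (hcg i).2, hl⟩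
  · rintro m ⟨c, hc, hcX, rfl⟩
    have := lt_card_of_strictMono hc (fun i => hX.2.1 _ (hcX i))
    omega

/-- The rank of a simplicial complex is the maximal dimension of its simplices. -/
lemma rankSet_eq_of_isSimplicialComplex {X : Set (Finset V)} (hX : IsSimplicialComplex X)
    {m : ℕ} (hle : ∀ g ∈ X, g.card ≤ m + 1) {g : Finset V} (hg : g ∈ X)
    (hgc : g.card = m + 1) : rankSet X = m := by
  have hne : X ≠ ∅ := fun e => by simp [e] at hg
  have : sSup (rank X '' X) = m := by
    refine IsGreatest.csSup_eq ⟨⟨g, hg, ?_⟩, ?_⟩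
    · rw [rank_eq_of_isSimplicialComplex hX hg]; omega
    · rintro _ ⟨s, hs, rfl⟩
      rw [rank_eq_of_isSimplicialComplex hX hs]
      have := hle s hs
      omega
  simp [rankSet, hne, this]

lemma card_le_of_rankSet_eq {X : Set (Finset V)} (hX : IsSimplicialComplex X)
    {m : ℕ} (hm : rankSet X = m) {g : Finset V} (hg : g ∈ X) : g.card ≤ m + 1 := by
  obtain ⟨s, hs, hmax⟩ := Set.exists_max_image X Finset.card hX.1 ⟨g, hg⟩
  have hpos := (hX.2.1 s hs).card_pos
  have := rankSet_eq_of_isSimplicialComplex hX (m := s.card - 1)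
    (fun t ht => by have := hmax t ht; omega) hs (by omega)
  have h1 := hmax g hg
  rw [hm] at this
  have h2 : m = s.card - 1 := by exact_mod_cast this
  omega

lemma alphaS_eq_simplexBoundary {X : Set (Finset V)} (hX : IsSimplicialComplex X)
    {g : Finset V} (hg : g ∈ X) : alphaS X g = simplexBoundary g := by
  ext s
  exact ⟨fun hs => ⟨hX.2.1 s hs.1, hs.2⟩, fun hs => ⟨hX.2.2.1 g hg s hs.1 hs.2.1, hs.2⟩⟩

/-- The neighborhood of a simplex is a surface iff its upper neighborhood is. -/
lemma isSurfaceAux_thetaS_iff {X : Set (Finset V)} (hX : IsSimplicialComplex X)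
    {g : Finset V} (hg : g ∈ X) {m : ℕ} :
    IsSurfaceAux m (thetaS X g) ↔ ∃ b, g.card + b = m + 1 ∧ IsSurfaceAux b (betaS X g) := by
  have hpos := (hX.2.1 g hg).card_pos
  have hlow : IsSurfaceAux (g.card - 1) (alphaS X g) := by
    rw [alphaS_eq_simplexBoundary hX hg]
    exact isSurfaceAux_simplexBoundary (by omega)
  have hlt : ∀ x ∈ alphaS X g, ∀ y ∈ betaS X g, x < y := fun x hx y hy => lt_trans hx.2 hy.2
  constructor
  · intro h
    obtain ⟨b, hb, hB⟩ := hlow.right_of_join h hlt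
    exact ⟨b, by omega, hB⟩
  · rintro ⟨b, hb, hB⟩
    have := hlow.join hB hlt
    rwa [show g.card - 1 + b = m by omega] at this

lemma mem_border_iff {X : Set α} {m : ℕ} (hm : rankSet X = m) {h : α} :
    h ∈ border X ↔ h ∈ X ∧ ¬ IsSurfaceAux m (thetaS X h) := by
  have : IsSurface (rankSet X - 1) (thetaS X h) ↔ IsSurfaceAux m (thetaS X h) := by
    constructor
    · rintro ⟨k, hk, hs⟩
      obtain rfl : k = m := by omega
      exact hs
    · exact fun hs => ⟨m, by omega, hs⟩
  simp only [border, Set.mem_ofPred_eq, this]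

lemma isSimplicialComplex_link {X : Set (Finset V)} (hX : IsSimplicialComplex X)
    (h : Finset V) : IsSimplicialComplex (link h X) := by
  have hsub : ∀ s ∈ link h X, ∀ t : Finset V, t.Nonempty → t ⊆ s → t ∈ link h X := by
    rintro s ⟨hs, hd, hu⟩ t ht hts
    refine ⟨hX.2.2.1 s hs t ht hts, ?_, hX.2.2.1 _ hu _ (ht.mono Finset.subset_union_right)
      (Finset.union_subset_union_right hts)⟩
    exact Finset.subset_empty.1 (hd ▸ Finset.inter_subset_inter_left hts)
  exact ⟨hX.1.subset (fun s hs => hs.1), fun s hs => hX.2.1 s hs.1, hsub,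
    fun s hs t _ hne => hsub s hs _ hne Finset.inter_subset_left⟩

/-- Upper neighborhoods in a link are upper neighborhoods in the complex. -/
lemma isSurfaceAux_betaS_link_iff {X : Set (Finset V)} (hX : IsSimplicialComplex X)
    {h k : Finset V} (hk : k ∈ link h X) {m : ℕ} :
    IsSurfaceAux m (betaS (link h X) k) ↔ IsSurfaceAux m (betaS X (h ∪ k)) := by
  have hdisj : Disjoint h k := Finset.disjoint_iff_inter_eq_empty.2 hk.2.1
  have e1 : (fun s => h ∪ s) '' betaS (link h X) k = betaS X (h ∪ k) := by
    ext s
    constructor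
    · rintro ⟨t, ⟨⟨_, htd, htu⟩, hkt⟩, rfl⟩
      refine ⟨htu, Finset.union_subset_union_right hkt.1, fun hle => hkt.2 ?_⟩
      intro v hv
      refine (Finset.mem_union.1 (hle (Finset.mem_union_right h hv))).resolve_left fun hvh => ?_
      exact Finset.disjoint_left.1 (Finset.disjoint_iff_inter_eq_empty.2 htd) hvh hv
    · rintro ⟨hs, hlt⟩
      have hhs : h ⊆ s := Finset.subset_union_left.trans hlt.1
      have hks : k ⊆ s \ h := Finset.subset_sdiff.2
        ⟨Finset.subset_union_right.trans hlt.1, hdisj.symm⟩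
      have hu : h ∪ s \ h = s := Finset.union_sdiff_of_subset hhs
      refine ⟨s \ h, ⟨⟨hX.2.2.1 s hs _ ((hX.2.1 k hk.1).mono hks) Finset.sdiff_subset,
        Finset.inter_sdiff_self h s, by rwa [hu]⟩, hks, fun hle => hlt.2 ?_⟩, hu⟩
      rw [← hu]
      exact Finset.union_subset_union_right hle
  have hd : ∀ s ∈ betaS (link h X) k, Disjoint h s :=
    fun s hs => Finset.disjoint_iff_inter_eq_empty.2 hs.1.2.1
  have e2 : (fun s => s \ h) '' betaS X (h ∪ k) = betaS (link h X) k := by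
    rw [← e1, Set.image_image]
    refine (Set.image_congr fun s hs => ?_).trans (Set.image_id' _)
    exact Finset.union_sdiff_cancel_left (hd s hs)
  constructor
  · intro hs
    rw [← e1]
    exact hs.union_image hd
  · intro hs
    rw [← e2]
    exact hs.sdiff_image fun s hs => Finset.subset_union_left.trans hs.2.1

/-- The cofaces of a simplex with surface neighborhood have surface neighborhoods. -/
lemma isSurfaceAux_thetaS_of_lt {X : Set (Finset V)} (hX : IsSimplicialComplex X)
    {s t : Finset V} (hs : s ∈ X) (ht : t ∈ X) (hst : s < t) {m : ℕ}
    (hm : IsSurfaceAux m (thetaS X s)) : IsSurfaceAux m (thetaS X t) := by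
  rw [isSurfaceAux_thetaS_iff hX ht]
  obtain ⟨b, hb, hB⟩ := (isSurfaceAux_thetaS_iff hX hs).1 hm
  rcases b with _ | b
  · change betaS X s = ∅ at hB
    exact absurd (show t ∈ betaS X s from ⟨ht, hst⟩) (by simp [hB])
  have h1 := hB.neighborhood (x := t) ⟨ht, hst⟩
  have hcard := Finset.card_lt_card hst
  have h3 := Finset.card_sdiff_add_card_eq_card hst.1
  have hlow := (isSurfaceAux_simplexBoundary (m := t.card - s.card - 1) (g := t \ s)
    (by omega)).union_image
    (h := s) (fun u hu => (Finset.disjoint_sdiff (s := s) (t := t)).mono_right hu.2.1)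
  rw [union_image_simplexBoundary_sdiff hst.1] at hlow
  have e : thetaS (betaS X s) t = {u | s < u ∧ u < t} ∪ betaS X t := by
    ext u
    simp only [mem_thetaS, betaS, Set.mem_ofPred_eq, Set.mem_union]
    constructor
    · rintro ⟨⟨hu, hsu⟩, hut | hut⟩
      · exact Or.inl ⟨hsu, hut⟩
      · exact Or.inr ⟨hu, hut⟩
    · rintro (⟨hsu, hut⟩ | ⟨hu, hut⟩)
      · exact ⟨⟨hX.2.2.1 t ht u ((hX.2.1 s hs).mono hsu.1) hut.1, hsu⟩, Or.inl hut⟩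
      · exact ⟨⟨hu, hst.trans hut⟩, Or.inr hut⟩
  rw [e] at h1
  obtain ⟨c, hc, hC⟩ := hlow.right_of_join h1 (fun x hx y hy => lt_trans hx.2 hy.2)
  exact ⟨c, by omega, hC⟩

/-- A simplex together with a chain of `m` comparable simplices spans a simplex of
dimension at least `m`. -/
lemma exists_le_card_of_chain_thetaS {X : Set (Finset V)} (hX : IsSimplicialComplex X)
    {h : Finset V} (hh : h ∈ X) {m : ℕ} {c : Fin (m + 1) → Finset V} (hc : StrictMono c)
    (hcX : ∀ i, c i ∈ thetaS X h) : ∃ g ∈ X, h ⊆ g ∧ m + 2 ≤ g.card := by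
  have hcx : ∀ i, c i ∈ X ∧ (c i < h ∨ h < c i) := fun i => mem_thetaS.1 (hcX i)
  have hnot : h.card ∉ Finset.univ.image fun i => (c i).card := by
    simp only [Finset.mem_image, Finset.mem_univ, true_and, not_exists]
    intro i hi
    rcases (hcx i).2 with hlt | hlt
    · have := Finset.card_lt_card hlt; omega
    · have := Finset.card_lt_card hlt; omega
  have hmono : StrictMono fun i => (c i).card := fun i j hij => Finset.card_lt_card (hc hij)
  have hcard : (insert h.card (Finset.univ.image fun i => (c i).card)).card = m + 2 := by
    rw [Finset.card_insert_of_notMem hnot, Finset.card_image_of_injective _ hmono.injective]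
    simp
  have key : ∀ g : Finset V, h ⊆ g → c (Fin.last m) ⊆ g → m + 2 ≤ g.card := by
    intro g h1 h2
    have hsub : insert h.card (Finset.univ.image fun i => (c i).card) ⊆ Finset.Icc 1 g.card := by
      intro k hk
      simp only [Finset.mem_insert, Finset.mem_image, Finset.mem_univ, true_and] at hk
      rw [Finset.mem_Icc]
      rcases hk with rfl | ⟨i, rfl⟩
      · exact ⟨(hX.2.1 h hh).card_pos, Finset.card_le_card h1⟩
      · exact ⟨(hX.2.1 _ (hcx i).1).card_pos,
          Finset.card_le_card ((hc.monotone (Fin.le_last i)).trans h2)⟩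
    have := Finset.card_le_card hsub
    rw [hcard, Nat.card_Icc] at this
    omega
  rcases (hcx (Fin.last m)).2 with hlt | hlt
  · exact ⟨h, hh, Finset.Subset.refl h, key h (Finset.Subset.refl h) hlt.1⟩
  · exact ⟨_, (hcx (Fin.last m)).1, hlt.1, key _ hlt.1 (Finset.Subset.refl _)⟩

/-- In a simplicial PCM, the link of the border at a border simplex is the border of its link. -/
lemma link_border_eq_border_link {X : Set (Finset V)} (hX : IsSimplicialComplex X) {m : ℕ}
    (hpcm : IsPCMAux (m + 2) X) {h : Finset V} (hh : h ∈ border X) :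
    link h (border X) = border (link h X) := by
  have hrk : rankSet X = ((m + 1 : ℕ) : ℤ) := by exact_mod_cast hpcm.1
  have hhX : h ∈ X := hh.1
  have hpos := (hX.2.1 h hhX).card_pos
  obtain ⟨c, hc, hcX⟩ := ((hpcm.2.2.2 h hhX).1 hh).exists_chain
  obtain ⟨g, hg, hhg, hgc⟩ := exists_le_card_of_chain_thetaS hX hhX hc hcX
  have hgle := card_le_of_rankSet_eq hX hrk hg
  have hne : h ≠ g := by
    rintro rfl
    refine ((mem_border_iff hrk).1 hh).2 ((isSurfaceAux_thetaS_iff hX hhX).2 ⟨0, by omega, ?_⟩)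
    change betaS X h = ∅
    refine Set.eq_empty_of_forall_notMem ?_
    rintro s ⟨hs, hlt⟩
    have h1 := card_le_of_rankSet_eq hX hrk hs
    have h2 := Finset.card_lt_card hlt
    omega
  have hlt : h ⊂ g := Finset.ssubset_iff_subset_ne.2 ⟨hhg, hne⟩
  have hcl := Finset.card_lt_card hlt
  have hL := isSimplicialComplex_link hX h
  have hcu : ∀ k ∈ link h X, (h ∪ k).card = h.card + k.card := fun k hk =>
    Finset.card_union_of_disjoint (Finset.disjoint_iff_inter_eq_empty.2 hk.2.1)
  have hgl : g \ h ∈ link h X := ⟨hX.2.2.1 g hg _ (Finset.sdiff_nonempty.2 hlt.2)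
    Finset.sdiff_subset, Finset.inter_sdiff_self h g, by
      rwa [Finset.union_sdiff_of_subset hhg]⟩
  have hrL : rankSet (link h X) = ((m + 1 - h.card : ℕ) : ℤ) := by
    refine rankSet_eq_of_isSimplicialComplex hL ?_ hgl ?_
    · intro k hk
      have h1 := card_le_of_rankSet_eq hX hrk hk.2.2
      rw [hcu k hk] at h1
      omega
    · have := Finset.card_sdiff_add_card_eq_card hhg
      omega
  have key : ∀ k ∈ link h X, k ∈ border (link h X) ↔ h ∪ k ∈ border X := by
    intro k hk
    rw [mem_border_iff hrL, mem_border_iff hrk, isSurfaceAux_thetaS_iff hL hk,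
      isSurfaceAux_thetaS_iff hX hk.2.2, hcu k hk]
    simp only [hk, hk.2.2, true_and, isSurfaceAux_betaS_link_iff hX hk]
    refine not_congr (exists_congr fun b => and_congr_left fun _ => ?_)
    omega
  ext k
  constructor
  · rintro ⟨hk, hd, hu⟩
    exact (key k ⟨hk.1, hd, hu.1⟩).2 hu
  · intro hk
    have hkL : k ∈ link h X := hk.1
    have hu := (key k hkL).1 hk
    refine ⟨(mem_border_iff hrk).2 ⟨hkL.1, fun hs => ?_⟩, hkL.2.1, hu⟩
    refine ((mem_border_iff hrk).1 hu).2 (isSurfaceAux_thetaS_of_lt hX hkL.1 hkL.2.2 ?_ hs)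
    refine Finset.ssubset_iff_subset_ne.2 ⟨Finset.subset_union_right, fun e => ?_⟩
    have := hcu k hkL
    rw [← e] at this
    omega

end Complex

/-- If `X` is at the same time a simplicial complex of rank `n ≥ 1` and
an `n`-PCM, then for every `h ∈ ΔX`, the poset `lk(h, ΔX)` is order-isomorphic to
the poset `Δ(lk(h, X))`. -/
theorem statement_9 {V : Type*} [DecidableEq V] (X : Set (Finset V)) (n : ℤ) (hn : 1 ≤ n)
    (hsc : IsSimplicialComplex X) (hrk : rankSet X = n) (hpcm : IsPCM n X)
    (h : Finset V) (hh : h ∈ border X) :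
    Nonempty ((link h (border X)) ≃o (border (link h X))) := by
  obtain ⟨N, hN, hP⟩ := hpcm
  obtain ⟨m, rfl⟩ : ∃ m, N = m + 2 := ⟨N - 2, by omega⟩
  rw [link_border_eq_border_link hsc hP hh]
  exact ⟨OrderIso.refl _⟩

end PCMPaper
end

section
/- If X is at the same time a simplicial complex of rank n ≥ 0 and an n-PCM, then its border ΔX, regarded as a subposet of X, has rank exactly n − 1. -/
namespace PCMPaper

variable {α : Type*} [PartialOrder α]

/-- The elements of `X` strictly comparable to every element of `C`. -/
def chainLink (X C : Set α) : Set α := {x ∈ X | ∀ c ∈ C, x < c ∨ c < x}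

theorem chainLink_empty (X : Set α) : chainLink X ∅ = X := by
  simp [chainLink]

theorem chainLink_insert (X C : Set α) (a : α) :
    chainLink X (insert a C) = chainLink (thetaS X a) C := by
  ext x
  simp only [chainLink, thetaS, alphaS, betaS, Set.mem_insert_iff, forall_eq_or_imp,
    Set.mem_ofPred_eq, Set.mem_union]
  tauto

theorem not_mem_thetaS_self (X : Set α) (a : α) : a ∉ thetaS X a := by
  simp [thetaS, alphaS, betaS]

theorem thetaS_subset (X : Set α) (a : α) : thetaS X a ⊆ X := by
  rintro x (hx | hx) <;> exact hx.1

theorem subset_thetaS_of_isChain_insert {X C : Set α} {a : α} (ha : a ∉ C) (hCX : C ⊆ X)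
    (hC : IsChain (· < ·) (insert a C)) : C ⊆ thetaS X a := by
  intro c hc
  have hne : c ≠ a := fun h => ha (h ▸ hc)
  exact (hC (Set.mem_insert_of_mem a hc) (Set.mem_insert a C) hne).imp
    (fun h => ⟨hCX hc, h⟩) (fun h => ⟨hCX hc, h⟩)

theorem IsSurfaceAux.thetaS {k : ℕ} {X : Set α} {a : α} (hX : IsSurfaceAux (k + 1) X)
    (ha : a ∈ X) : IsSurfaceAux k (thetaS X a) := by
  cases k with
  | zero =>
    obtain ⟨x, y, hne, hxy, hyx, rfl⟩ := hX
    refine Set.eq_empty_iff_forall_notMem.2 fun b hb => ?_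
    simp only [PCMPaper.thetaS, alphaS, betaS, Set.mem_union, Set.mem_ofPred_eq,
      Set.mem_insert_iff, Set.mem_singleton_iff] at ha hb
    rcases ha with rfl | rfl <;> rcases hb with ⟨rfl | rfl, h⟩ | ⟨rfl | rfl, h⟩ <;>
      first | exact lt_irrefl _ h | exact hxy h | exact hyx h
  | succ k => exact hX.2.2 a ha

theorem IsSurfaceAux.chainLink {n : ℕ} (C : Finset α) :
    ∀ {X : Set α}, IsSurfaceAux (n + C.card) X → (C : Set α) ⊆ X →
      IsChain (· < ·) (C : Set α) → IsSurfaceAux n (chainLink X C) := by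
  classical
  induction C using Finset.induction_on with
  | empty =>
    intro X hX _ _
    simpa [chainLink_empty] using hX
  | insert a s ha ih =>
    intro X hX hCX hC
    rw [Finset.card_insert_of_notMem ha, ← add_assoc] at hX
    rw [Finset.coe_insert] at hCX hC ⊢
    rw [chainLink_insert]
    exact ih (hX.thetaS (hCX (Set.mem_insert _ _)))
      (subset_thetaS_of_isChain_insert (by simpa using ha)
        ((Set.subset_insert _ _).trans hCX) hC)
      (hC.mono (Set.subset_insert _ _))

theorem exists_insert_chainLink_eq_singleton {n : ℕ} {X : Set α} {h : α} (hh : h ∈ X)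
    (H : ∃ C : Finset α, (C : Set α) ⊆ thetaS X h ∧ IsChain (· < ·) (C : Set α) ∧
      C.card = n ∧ ∃ x, chainLink (thetaS X h) C = {x}) :
    ∃ C : Finset α, h ∈ C ∧ (C : Set α) ⊆ X ∧ IsChain (· < ·) (C : Set α) ∧
      C.card = n + 1 ∧ ∃ x, chainLink X C = {x} := by
  classical
  obtain ⟨C, hCX, hC, hcard, x, hx⟩ := H
  have hhC : h ∉ C := fun hc => not_mem_thetaS_self X h (hCX hc)
  refine ⟨insert h C, Finset.mem_insert_self _ _, ?_, ?_, ?_, x, ?_⟩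
  · rw [Finset.coe_insert]
    exact Set.insert_subset hh (hCX.trans (thetaS_subset X h))
  · rw [Finset.coe_insert]
    refine hC.insert fun b hb _ => ?_
    exact (hCX hb).symm.imp (·.2) (·.2)
  · rw [Finset.card_insert_of_notMem hhC, hcard]
  · rw [Finset.coe_insert, chainLink_insert, hx]

theorem IsPCMAux.exists_chainLink_eq_singleton {n : ℕ} :
    ∀ {X : Set α}, IsPCMAux (n + 1) X → ∃ C : Finset α, (C : Set α) ⊆ X ∧
      IsChain (· < ·) (C : Set α) ∧ C.card = n ∧ ∃ x, chainLink X C = {x} := by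
  induction n with
  | zero =>
    rintro X ⟨x, rfl⟩
    exact ⟨∅, by simp, by simp, rfl, x, by simp [chainLink_empty]⟩
  | succ n ih =>
    rintro X ⟨-, -, hne, H⟩
    obtain ⟨h, hh⟩ := Set.nonempty_iff_ne_empty.2 hne
    obtain ⟨C, -, hC⟩ := exists_insert_chainLink_eq_singleton hh.1 (ih ((H h hh.1).1 hh))
    exact ⟨C, hC⟩

theorem subset_border_of_chainLink_eq_singleton {X : Set α} {C : Finset α} {x : α}
    (hrk : rankSet X = C.card) (hCX : (C : Set α) ⊆ X) (hC : IsChain (· < ·) (C : Set α))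
    (hx : chainLink X C = {x}) : (C : Set α) ⊆ border X := by
  classical
  intro c hc
  refine ⟨hCX hc, ?_⟩
  rintro ⟨m, hm, hS⟩
  have hcC : c ∈ C := hc
  have hm' : m = 1 + (C.erase c).card := by
    have := Finset.card_erase_add_one hcC
    omega
  have hins : (C : Set α) = insert c (C.erase c : Set α) := by
    rw [← Finset.coe_insert, Finset.insert_erase hcC]
  rw [hins] at hC hCX hx
  rw [hm'] at hS
  have h1 := hS.chainLink (C.erase c)
    (subset_thetaS_of_isChain_insert (by simp) ((Set.subset_insert _ _).trans hCX) hC)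
    (hC.mono (Set.subset_insert _ _))
  rw [← chainLink_insert, hx] at h1
  obtain ⟨a, b, hab, -, -, h⟩ := h1
  have ha : a ∈ ({x} : Set α) := h ▸ Set.mem_insert a _
  have hb : b ∈ ({x} : Set α) := h ▸ Set.mem_insert_of_mem a rfl
  exact hab (ha.trans hb.symm)

section Simplices

variable {V : Type*}

theorem succ_le_card_of_strictMono {m : ℕ} {c : Fin (m + 1) → Finset V} (hc : StrictMono c)
    (hne : ∀ i, (c i).Nonempty) : m + 1 ≤ (c (Fin.last m)).card := by
  have key : ∀ i : ℕ, ∀ hi : i < m + 1, i + 1 ≤ (c ⟨i, hi⟩).card := by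
    intro i
    induction i with
    | zero => exact fun hi => (hne _).card_pos
    | succ i ih =>
      intro hi
      have h1 := ih (by omega)
      have h2 := Finset.card_lt_card
        (hc (show (⟨i, by omega⟩ : Fin (m + 1)) < ⟨i + 1, hi⟩ from Nat.lt_succ_self i))
      omega
  exact key m (by omega)

theorem rank_lt_card {X : Set (Finset V)} (hne : ∀ h ∈ X, h.Nonempty) {h : Finset V}
    (hh : h ∈ X) : rank X h < h.card := by
  have hpos := (hne h hh).card_pos
  have : rank X h ≤ h.card - 1 := by
    refine csSup_le' ?_
    rintro m ⟨c, hc, hcX, rfl⟩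
    have := succ_le_card_of_strictMono hc fun i => hne _ (hcX i)
    omega
  omega

theorem le_rank {X : Set (Finset V)} (hne : ∀ h ∈ X, h.Nonempty) {m : ℕ}
    {c : Fin (m + 1) → Finset V} (hc : StrictMono c) (hcX : ∀ i, c i ∈ X) :
    m ≤ rank X (c (Fin.last m)) := by
  refine le_csSup ⟨(c (Fin.last m)).card, ?_⟩ ⟨c, hc, hcX, rfl⟩
  rintro k ⟨d, hd, hdX, hdl⟩
  have := succ_le_card_of_strictMono hd fun i => hne _ (hdX i)
  rw [hdl] at this
  omega

theorem le_rankSet {X : Set (Finset V)} (hfin : X.Finite) (hne : ∀ h ∈ X, h.Nonempty) {m : ℕ}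
    {c : Fin (m + 1) → Finset V} (hc : StrictMono c) (hcX : ∀ i, c i ∈ X) :
    (m : ℤ) ≤ rankSet X := by
  rw [rankSet, if_neg (Set.nonempty_iff_ne_empty.1 ⟨_, hcX 0⟩)]
  exact_mod_cast (le_rank hne hc hcX).trans
    (le_csSup (hfin.image _).bddAbove ⟨_, hcX (Fin.last m), rfl⟩)

theorem rankSet_le {X : Set (Finset V)} (hne : ∀ h ∈ X, h.Nonempty) {n : ℕ}
    (hcard : ∀ h ∈ X, h.card ≤ n + 1) : rankSet X ≤ n := by
  rw [rankSet]
  split_ifs with hX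
  · omega
  · refine Int.ofNat_le.2 (csSup_le' ?_)
    rintro _ ⟨h, hh, rfl⟩
    have h1 := rank_lt_card hne hh
    have h2 := hcard h hh
    omega

theorem exists_strictMono_subsets {m : ℕ} {h : Finset V} (hm : h.card = m + 1) :
    ∃ c : Fin (m + 1) → Finset V, StrictMono c ∧ ∀ i, (c i).Nonempty ∧ c i ⊆ h := by
  let e : Fin (m + 1) ↪ V :=
    (h.equivFinOfCardEq hm).symm.toEmbedding.trans (Function.Embedding.subtype _)
  refine ⟨fun i => (Finset.Iic i).map e, ?_, fun i => ⟨?_, ?_⟩⟩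
  · intro i j hij
    refine (Finset.mapEmbedding e).strictMono ?_
    exact Finset.Iic_ssubset_Iic.2 hij
  · exact Finset.Nonempty.map ⟨i, by simp⟩
  · intro v hv
    obtain ⟨j, -, rfl⟩ := Finset.mem_map.1 hv
    exact ((h.equivFinOfCardEq hm).symm j).2

theorem IsSimplicialComplex.card_le [DecidableEq V] {X : Set (Finset V)}
    (hX : IsSimplicialComplex X) {h : Finset V} (hh : h ∈ X) : (h.card : ℤ) ≤ rankSet X + 1 := by
  obtain ⟨hfin, hne, hsub, -⟩ := hX
  have hpos := (hne h hh).card_pos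
  obtain ⟨c, hc, hch⟩ := exists_strictMono_subsets (show h.card = (h.card - 1) + 1 by omega)
  have := le_rankSet hfin hne hc fun i => hsub h hh _ (hch i).1 (hch i).2
  omega

theorem card_lt_card_iff_of_isChain {C : Set (Finset V)} (hC : IsChain (· < ·) C)
    {a b : Finset V} (ha : a ∈ C) (hb : b ∈ C) : a.card < b.card ↔ a < b := by
  refine ⟨fun h => ?_, fun h => Finset.card_lt_card h⟩
  refine (hC ha hb (by rintro rfl; exact lt_irrefl _ h)).resolve_right fun h' => ?_
  exact lt_asymm h (Finset.card_lt_card h')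

theorem exists_card_eq_of_isChain {C : Finset (Finset V)}
    (hC : IsChain (· < ·) (C : Set (Finset V))) (hne : ∀ c ∈ C, c.Nonempty)
    (hle : ∀ c ∈ C, c.card ≤ C.card) {i : ℕ} (h1 : 1 ≤ i) (h2 : i ≤ C.card) :
    ∃ c ∈ C, c.card = i := by
  have hinj : Set.InjOn Finset.card (C : Set (Finset V)) := by
    intro a ha b hb hab
    by_contra hne
    rcases hC ha hb hne with h | h
    · exact (Finset.card_lt_card h).ne hab
    · exact (Finset.card_lt_card h).ne' hab
  have himg : C.image Finset.card = Finset.Icc 1 C.card := by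
    refine Finset.eq_of_subset_of_card_le ?_ ?_
    · intro k hk
      obtain ⟨c, hc, rfl⟩ := Finset.mem_image.1 hk
      exact Finset.mem_Icc.2 ⟨(hne c hc).card_pos, hle c hc⟩
    · rw [Finset.card_image_of_injOn hinj]
      simp
  exact Finset.mem_image.1 (himg ▸ Finset.mem_Icc.2 ⟨h1, h2⟩)

/-- In a simplicial complex, a chain missing a single rank determines its unique completion
only if the missing rank is the top one. -/
theorem IsSimplicialComplex.card_eq_of_chainLink_eq_singleton [DecidableEq V]
    {X : Set (Finset V)} (hX : IsSimplicialComplex X) {C : Finset (Finset V)}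
    (hle : ∀ h ∈ X, h.card ≤ C.card + 1) (hCX : (C : Set (Finset V)) ⊆ X)
    (hC : IsChain (· < ·) (C : Set (Finset V))) {x : Finset V} (hx : chainLink X C = {x}) :
    x.card = C.card + 1 := by
  obtain ⟨-, hne, hsub, -⟩ := hX
  obtain ⟨hxX, hxC⟩ : x ∈ chainLink X C := hx ▸ rfl
  have hxnC : x ∉ C := fun h => by simpa using hxC x h
  have hDcard := Finset.card_insert_of_notMem hxnC
  have hDX : ∀ d ∈ insert x C, d ∈ X := by
    intro d hd
    rcases Finset.mem_insert.1 hd with rfl | hd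
    exacts [hxX, hCX hd]
  have hD : IsChain (· < ·) ((insert x C : Finset (Finset V)) : Set (Finset V)) := by
    rw [Finset.coe_insert]
    exact hC.insert fun b hb _ => hxC b hb
  have hex : ∀ i, 1 ≤ i → i ≤ C.card + 1 → ∃ d ∈ insert x C, d.card = i := fun i h1 h2 =>
    exists_card_eq_of_isChain hD (fun d hd => hne d (hDX d hd))
      (fun d hd => hDcard ▸ hle d (hDX d hd)) h1 (hDcard ▸ h2)
  have hxD : x ∈ insert x C := Finset.mem_insert_self _ _
  have hxpos := (hne x hxX).card_pos
  by_contra hcon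
  have hxle : x.card ≤ C.card := by have := hle x hxX; omega
  obtain ⟨y, hyD, hy⟩ := hex (x.card + 1) (by omega) (by omega)
  have hxy : x < y := (card_lt_card_iff_of_isChain hD hxD hyD).1 (by omega)
  obtain ⟨z, hzx, hzc, hzC⟩ : ∃ z, z < x ∧ z.card + 1 = x.card ∧ ∀ c ∈ C, c < x → c ≤ z := by
    by_cases h1 : x.card = 1
    · refine ⟨∅, Finset.empty_ssubset.2 (hne x hxX), by simp [h1], fun c hc hcx => ?_⟩
      have := Finset.card_lt_card hcx
      have := (hne c (hCX hc)).card_pos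
      omega
    · obtain ⟨z, hzD, hz⟩ := hex (x.card - 1) (by omega) (by omega)
      refine ⟨z, (card_lt_card_iff_of_isChain hD hzD hxD).1 (by omega), by omega,
        fun c hc hcx => ?_⟩
      by_contra hcz
      have hcD := Finset.mem_insert_of_mem (b := x) hc
      have h2 := (hD hzD hcD (by rintro rfl; exact hcz le_rfl)).resolve_right
        fun h => hcz h.le
      have := Finset.card_lt_card h2
      have := Finset.card_lt_card hcx
      omega
  obtain ⟨v, hvy, hvx⟩ := Finset.exists_of_ssubset hxy
  have hvz : v ∉ z := fun h => hvx (hzx.le h)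
  have hcard := Finset.card_insert_of_notMem hvz
  have hsy : insert v z ⊆ y := Finset.insert_subset hvy (hzx.le.trans hxy.le)
  have hlty : insert v z < y :=
    Finset.ssubset_iff_subset_ne.2 ⟨hsy, by intro h; rw [h] at hcard; omega⟩
  have hmem : insert v z ∈ chainLink X C := by
    refine ⟨hsub y (hDX y hyD) _ (Finset.insert_nonempty _ _) hsy, fun c hc => ?_⟩
    have hcD := Finset.mem_insert_of_mem (b := x) hc
    rcases hxC c hc with h | h
    · left
      by_cases hcy : c = y
      · exact hcy ▸ hlty
      · refine hlty.trans ((hD hyD hcD (Ne.symm hcy)).resolve_right fun h' => ?_)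
        have := Finset.card_lt_card h
        have := Finset.card_lt_card h'
        omega
    · exact Or.inr ((hzC c hc h).trans_lt (Finset.ssubset_insert hvz))
  rw [hx] at hmem
  exact hvx ((Set.mem_singleton_iff.1 hmem) ▸ Finset.mem_insert_self v z)

end Simplices

/-- If `X` is at the same time a simplicial complex of rank `n ≥ 0` and
an `n`-PCM, its border `ΔX` has rank exactly `n - 1`. -/
theorem statement_10 {V : Type*} [DecidableEq V] (X : Set (Finset V)) (n : ℤ) (hn : 0 ≤ n)
    (hsc : IsSimplicialComplex X) (hrk : rankSet X = n) (hpcm : IsPCM n X) :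
    rankSet (border X) = n - 1 := by
  obtain ⟨m, hm, hP⟩ := hpcm
  obtain ⟨n, rfl⟩ := Int.eq_ofNat_of_zero_le hn
  obtain rfl : m = n + 1 := by omega
  have hfin := hsc.1
  have hne := hsc.2.1
  have hle : ∀ h ∈ X, h.card ≤ n + 1 := fun h hh => by
    have := hsc.card_le hh
    omega
  cases n with
  | zero =>
    have hempty : border X = ∅ := by
      obtain ⟨x, rfl⟩ := hP
      refine Set.eq_empty_iff_forall_notMem.2 fun h hh => hh.2 ⟨0, by simp [hrk], ?_⟩
      refine Set.eq_empty_iff_forall_notMem.2 fun y hy => ?_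
      have h1 : y = x := Set.mem_singleton_iff.1 (thetaS_subset _ _ hy)
      have h2 : h = x := Set.mem_singleton_iff.1 hh.1
      subst h1 h2
      exact not_mem_thetaS_self _ _ hy
    simp [rankSet, hempty]
  | succ n =>
    have hborder : ∀ h ∈ border X, h.card ≤ n + 1 := by
      intro h hh
      obtain ⟨C, hhC, hCX, hC, hcard, x, hx⟩ := exists_insert_chainLink_eq_singleton hh.1
        ((hP.2.2.2 h hh.1).1 hh).exists_chainLink_eq_singleton
      have hxcard := hsc.card_eq_of_chainLink_eq_singleton (hcard ▸ hle) hCX hC hx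
      have hxC : x ∈ chainLink X C := hx ▸ rfl
      have := hle h hh.1
      have := hle x hxC.1
      rcases hxC.2 h hhC with h' | h' <;>
      · have := Finset.card_lt_card h'
        omega
    have hbne : ∀ h ∈ border X, h.Nonempty := fun h hh => hne h hh.1
    obtain ⟨C, hCX, hC, hcard, x, hx⟩ := hP.exists_chainLink_eq_singleton
    have hCb := subset_border_of_chainLink_eq_singleton (by rw [hrk, hcard]) hCX hC hx
    have hex : ∀ i : Fin (n + 1), ∃ c ∈ C, c.card = i + 1 := fun i =>
      exists_card_eq_of_isChain hC (fun c hc => hne c (hCX hc))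
        (fun c hc => hcard ▸ hborder c (hCb hc)) (by omega) (by omega)
    choose c hcC hc using hex
    have hmono : StrictMono c := fun i j hij =>
      (card_lt_card_iff_of_isChain hC (hcC i) (hcC j)).1 (by rw [hc, hc]; omega)
    have h1 := le_rankSet (hfin.subset fun h hh => hh.1) hbne hmono fun i => hCb (hcC i)
    have h2 := rankSet_le hbne hborder
    push_cast
    omega

end PCMPaper
end
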